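/- arXiv:1412.3623 — 5 statements merged into one kernel-verified Lean document; each statement's English description precedes it below -/
import Mathlib

section
/- Let a < b be real numbers, h = b − a, let p be a natural number, and let f : ℝ → ℝ be (p+1)-times continuously differentiable on [a,b]. Then there exists a polynomial q of degree at most p such that ‖f − q‖_{L²(a,b)} ≤ h^{p+1} · ‖f^{(p+1)}‖_{L²(a,b)}. -/
open MeasureTheory intervalIntegral

/-- Every polynomial over a field of characteristic zero has an antiderivative. -/
theorem Polynomial.exists_derivative_eq {K : Type*} [Field K] [CharZero K] (r : Polynomial K) :
    ∃ q : Polynomial K, q.derivative = r := by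
  induction r using Polynomial.induction_on' with
  | add r s hr hs =>
    obtain ⟨q, rfl⟩ := hr
    obtain ⟨t, rfl⟩ := hs
    exact ⟨q + t, Polynomial.derivative_add⟩
  | monomial n c =>
    refine ⟨Polynomial.monomial (n + 1) (c / (n + 1)), ?_⟩
    have hn : (n : K) + 1 ≠ 0 := Nat.cast_add_one_ne_zero n
    rw [Polynomial.derivative_monomial]
    simp [hn]

/-- A pointwise form of the **Poincaré inequality** for functions vanishing at the left endpoint. -/
theorem sq_le_mul_integral_sq_derivWithin {a b : ℝ} {u : ℝ → ℝ}
    (hu : ContDiffOn ℝ 1 u (Set.Icc a b)) (ha : u a = 0) {x : ℝ} (hx : x ∈ Set.Icc a b)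
    (hab : a < b) :
    u x ^ 2 ≤ (b - a) * ∫ t in a..b, derivWithin u (Set.Icc a b) t ^ 2 := by
  set v := derivWithin u (Set.Icc a b) with hv
  have hvc : ContinuousOn v (Set.Icc a b) :=
    hu.continuousOn_derivWithin (uniqueDiffOn_Icc hab) le_rfl
  have hsub : Set.Icc a x ⊆ Set.Icc a b := Set.Icc_subset_Icc_right hx.2
  have hvi : IntervalIntegrable v volume a x :=
    (hvc.mono hsub).intervalIntegrable_of_Icc hx.1
  have hv2i : IntervalIntegrable (fun t => v t ^ 2) volume a x :=
    ((hvc.mono hsub).pow 2).intervalIntegrable_of_Icc hx.1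
  have hux : ∫ t in a..x, v t = u x := by
    rw [integral_eq_sub_of_hasDerivAt_of_le hx.1 (hu.continuousOn.mono hsub) _ hvi, ha, sub_zero]
    intro t ht
    have htb : t < b := ht.2.trans_le hx.2
    exact ((hu.differentiableOn one_ne_zero t ⟨ht.1.le, htb.le⟩).hasDerivWithinAt).hasDerivAt
      (Icc_mem_nhds ht.1 htb)
  have hmono : ∫ t in a..x, v t ^ 2 ≤ ∫ t in a..b, v t ^ 2 :=
    integral_mono_interval le_rfl hx.1 hx.2 (.of_forall fun _ => sq_nonneg _)
      ((hvc.pow 2).intervalIntegrable_of_Icc hab.le)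
  have hL : 0 < b - a := sub_pos.2 hab
  set c := u x / (b - a) with hc
  have hcu : u x = c * (b - a) := by rw [hc]; field_simp
  have hexp : ∫ t in a..x, (v t - c) ^ 2 =
      (∫ t in a..x, v t ^ 2) - 2 * c * u x + c ^ 2 * (x - a) := by
    have h : ∀ t, (v t - c) ^ 2 = v t ^ 2 - 2 * c * v t + c ^ 2 := fun t => by ring
    simp_rw [h]
    rw [integral_add (hv2i.sub (hvi.const_mul _)) intervalIntegrable_const,
      integral_sub hv2i (hvi.const_mul _), intervalIntegral.integral_const_mul, hux,
      intervalIntegral.integral_const, smul_eq_mul]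
    ring
  have hnonneg : 0 ≤ ∫ t in a..x, (v t - c) ^ 2 :=
    integral_nonneg hx.1 fun _ _ => sq_nonneg _
  have hxb : c ^ 2 * (x - a) ≤ c ^ 2 * (b - a) := by
    gcongr
    exact hx.2
  rw [hexp, hcu] at hnonneg
  have hfin : c ^ 2 * (b - a) ≤ ∫ t in a..b, v t ^ 2 := by linarith
  calc u x ^ 2 = (b - a) * (c ^ 2 * (b - a)) := by rw [hcu]; ring
    _ ≤ _ := by gcongr

/-- The **Poincaré inequality** for functions vanishing at the left endpoint of an interval. -/
theorem integral_sq_le_mul_integral_sq_derivWithin {a b : ℝ} {u : ℝ → ℝ}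
    (hu : ContDiffOn ℝ 1 u (Set.Icc a b)) (ha : u a = 0) (hab : a < b) :
    ∫ x in a..b, u x ^ 2 ≤ (b - a) ^ 2 * ∫ x in a..b, derivWithin u (Set.Icc a b) x ^ 2 := by
  calc ∫ x in a..b, u x ^ 2
      ≤ ∫ _ in a..b, (b - a) * ∫ t in a..b, derivWithin u (Set.Icc a b) t ^ 2 :=
        integral_mono_on hab.le ((hu.continuousOn.pow 2).intervalIntegrable_of_Icc hab.le)
          intervalIntegrable_const fun x hx => sq_le_mul_integral_sq_derivWithin hu ha hx hab
    _ = _ := by rw [intervalIntegral.integral_const, smul_eq_mul]; ring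

/-- A polynomial approximation of the derivative of `f` integrates to a polynomial approximation
of `f`. -/
theorem exists_derivative_eq_and_integral_sq_sub_le {a b : ℝ} (hab : a < b) {f : ℝ → ℝ}
    (hf : ContDiffOn ℝ 1 f (Set.Icc a b)) (r : Polynomial ℝ) :
    ∃ q : Polynomial ℝ, q.derivative = r ∧
      ∫ x in a..b, (f x - q.eval x) ^ 2 ≤
        (b - a) ^ 2 * ∫ x in a..b, (derivWithin f (Set.Icc a b) x - r.eval x) ^ 2 := by
  obtain ⟨s, rfl⟩ := r.exists_derivative_eq
  refine ⟨s + Polynomial.C (f a - s.eval a), by simp, ?_⟩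
  set q := s + Polynomial.C (f a - s.eval a) with hq
  have hqs : q.derivative = s.derivative := by simp [hq]
  have hu : ContDiffOn ℝ 1 (fun x => f x - q.eval x) (Set.Icc a b) :=
    hf.sub (by simpa [Polynomial.coe_aeval_eq_eval] using 
      (q.contDiff_aeval (𝕜 := ℝ) 1).contDiffOn)
  refine (integral_sq_le_mul_integral_sq_derivWithin hu (by simp [hq]) hab).trans_eq ?_
  congr 1
  refine integral_congr fun x hx => ?_
  rw [Set.uIcc_of_le hab.le] at hx
  have hd := (hf.differentiableOn one_ne_zero x hx).hasDerivWithinAt.sub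
    (q.hasDerivAt x).hasDerivWithinAt
  have := hd.derivWithin (uniqueDiffOn_Icc hab x hx)
  rw [hqs] at this
  exact congrArg (· ^ 2) this

/-- The squared form of the `L²` best approximation bound by polynomials of degree at most `p`. -/
theorem exists_natDegree_le_and_integral_sq_sub_le {a b : ℝ} (hab : a < b) (p : ℕ) {f : ℝ → ℝ}
    (hf : ContDiffOn ℝ (p + 1) f (Set.Icc a b)) :
    ∃ q : Polynomial ℝ, q.natDegree ≤ p ∧
      ∫ x in a..b, (f x - q.eval x) ^ 2 ≤
        ((b - a) ^ (p + 1)) ^ 2 *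
          ∫ x in a..b, (iteratedDerivWithin (p + 1) f (Set.Icc a b) x) ^ 2 := by
  induction p generalizing f with
  | zero =>
    obtain ⟨q, hq, h⟩ := exists_derivative_eq_and_integral_sq_sub_le hab (by simpa using hf) 0
    refine ⟨q, (Polynomial.derivative_eq_zero.1 hq).le, ?_⟩
    simpa [iteratedDerivWithin_succ', iteratedDerivWithin_zero] using h
  | succ p ih =>
    obtain ⟨r, hr, hle⟩ := ih (f := derivWithin f (Set.Icc a b))
      (hf.derivWithin (uniqueDiffOn_Icc hab) (by push_cast; exact le_rfl))
    obtain ⟨q, rfl, h⟩ := exists_derivative_eq_and_integral_sq_sub_le hab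
      (hf.of_le (by simp)) r
    rw [Polynomial.natDegree_derivative] at hr
    refine ⟨q, by omega, h.trans ?_⟩
    rw [iteratedDerivWithin_succ', pow_succ' _ (p + 1), mul_pow, mul_assoc]
    gcongr

/-- Proposition 2: the best L² approximation of f on an interval of length h = b - a by
polynomials of degree at most p is bounded by h^(p+1) times the L² norm of the (p+1)-th
derivative of f. -/
theorem best_polynomial_L2_approximation (a b : ℝ) (hab : a < b) (p : ℕ) (f : ℝ → ℝ)
    (hf : ContDiffOn ℝ (p + 1) f (Set.Icc a b)) :
    ∃ q : Polynomial ℝ, q.natDegree ≤ p ∧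
      Real.sqrt (∫ x in a..b, (f x - q.eval x) ^ 2) ≤
        (b - a) ^ (p + 1) *
          Real.sqrt (∫ x in a..b, (iteratedDerivWithin (p + 1) f (Set.Icc a b) x) ^ 2) := by
  obtain ⟨q, hq, h⟩ := exists_natDegree_le_and_integral_sq_sub_le hab p hf
  refine ⟨q, hq, (Real.sqrt_le_sqrt h).trans_eq ?_⟩
  rw [Real.sqrt_mul (sq_nonneg _), Real.sqrt_sq (pow_nonneg (sub_nonneg.2 hab.le) _)]
end

section
/- There exists a constant C > 0 such that for every bounded convex open set Ω ⊂ ℝ² of diameter h and every function f : ℝ² → ℝ that is twice continuously differentiable on a neighbourhood of the closure of Ω, there exists an affine function q : ℝ² → ℝ with ‖f − q‖_{L²(Ω)} ≤ C · h² · (∫_Ω ‖D²f(x)‖² dx)^{1/2}, where D²f(x) is the second (Fréchet) derivative of f at x and ‖D²f(x)‖ its operator norm. -/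
open MeasureTheory

lemma sq_intervalIntegral_le_of_continuousOn {g : ℝ → ℝ} (hg : ContinuousOn g (Set.uIcc 0 1)) :
    (∫ t in (0 : ℝ)..1, g t) ^ 2 ≤ ∫ t in (0 : ℝ)..1, g t ^ 2 := by
  set c := ∫ t in (0 : ℝ)..1, g t with hc
  have hg₁ : IntervalIntegrable g volume 0 1 := hg.intervalIntegrable
  have hg₂ : IntervalIntegrable (fun t => g t ^ 2) volume 0 1 := (hg.pow 2).intervalIntegrable
  have hnonneg : 0 ≤ ∫ t in (0 : ℝ)..1, (g t - c) ^ 2 :=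
    intervalIntegral.integral_nonneg zero_le_one fun t _ => sq_nonneg _
  have hexpand : ∫ t in (0 : ℝ)..1, (g t - c) ^ 2 = (∫ t in (0 : ℝ)..1, g t ^ 2) - c ^ 2 := by
    have : ∀ t, (g t - c) ^ 2 = g t ^ 2 - (2 * c) * g t + c ^ 2 := fun t => by ring
    simp_rw [this]
    rw [intervalIntegral.integral_add (hg₂.sub (hg₁.const_mul _)) intervalIntegrable_const,
      intervalIntegral.integral_sub hg₂ (hg₁.const_mul _), intervalIntegral.integral_const_mul,
      intervalIntegral.integral_const, ← hc]
    simp only [sub_zero, smul_eq_mul]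
    ring
  linarith

lemma ContDiffOn.continuousOn_iteratedFDeriv_two {E : Type*} [NormedAddCommGroup E]
    [NormedSpace ℝ E] {f : E → ℝ} {U : Set E} (hf : ContDiffOn ℝ 2 f U) (hU : IsOpen U) :
    ContinuousOn (iteratedFDeriv ℝ 2 f) U :=
  (hf.continuousOn_iteratedFDerivWithin (m := 2) le_rfl hU.uniqueDiffOn).congr
    fun _ hx => (iteratedFDerivWithin_of_isOpen 2 hU hx).symm

lemma taylor_remainder_sq_le {E : Type*} [NormedAddCommGroup E] [NormedSpace ℝ E]
    {f : E → ℝ} {U : Set E} (hU : IsOpen U) (hf : ContDiffOn ℝ 2 f U) {x y : E}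
    (hxy : ∀ t ∈ Set.Icc (0 : ℝ) 1, (1 - t) • y + t • x ∈ U) :
    (f x - (f y + fderiv ℝ f y (x - y))) ^ 2 ≤
      ‖x - y‖ ^ 4 * ∫ t in (0 : ℝ)..1,
        (1 - t) ^ 2 * ‖iteratedFDeriv ℝ 2 f ((1 - t) • y + t • x)‖ ^ 2 := by
  set p : ℝ → E := fun t => (1 - t) • y + t • x with hp
  set v := x - y with hv
  have hp_cont : Continuous p := by fun_prop
  have hp_deriv (t : ℝ) : HasDerivAt p v t := by
    have h₁ : HasDerivAt (fun t : ℝ => (1 - t) • y) ((-1 : ℝ) • y) t :=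
      ((hasDerivAt_id t).const_sub 1).smul_const y
    have h₂ : HasDerivAt (fun t : ℝ => t • x) ((1 : ℝ) • x) t :=
      (hasDerivAt_id t).smul_const x
    refine (h₁.add h₂).congr_deriv ?_
    rw [hv]; module
  have hD := hf.continuousOn_iteratedFDeriv_two hU
  rw [← Set.uIcc_of_le zero_le_one] at hxy
  have hDp : ContinuousOn (fun t => iteratedFDeriv ℝ 2 f (p t)) (Set.uIcc 0 1) :=
    hD.comp hp_cont.continuousOn hxy
  have hw : ContinuousOn (fun t : ℝ => 1 - t) (Set.uIcc 0 1) := by fun_prop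
  have hR : ContinuousOn (fun t => (1 - t) * fderiv ℝ (fderiv ℝ f) (p t) v v)
      (Set.uIcc 0 1) := by
    have h₁ : ContinuousOn (fun t => iteratedFDeriv ℝ 2 f (p t) fun _ => v) (Set.uIcc 0 1) :=
      (ContinuousMultilinearMap.apply ℝ (fun _ : Fin 2 => E) ℝ
        (fun _ => v)).continuous.comp_continuousOn hDp
    simp only [iteratedFDeriv_two_apply] at h₁
    exact hw.mul h₁
  have hFTC : ∫ t in (0 : ℝ)..1, (1 - t) * fderiv ℝ (fderiv ℝ f) (p t) v v =
      f x - (f y + fderiv ℝ f y v) := by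
    rw [intervalIntegral.integral_eq_sub_of_hasDerivAt
      (f := fun t => f (p t) + (1 - t) * fderiv ℝ f (p t) v) _ hR.intervalIntegrable]
    · simp [hp]
    · intro t ht
      have hfat : ContDiffAt ℝ 2 f (p t) := hf.contDiffAt (hU.mem_nhds (hxy t ht))
      have h₁ : HasDerivAt (fun t => f (p t)) (fderiv ℝ f (p t) v) t :=
        (hfat.differentiableAt (by norm_num)).hasFDerivAt.comp_hasDerivAt t (hp_deriv t)
      have h₂ : HasDerivAt (fun t => fderiv ℝ f (p t)) (fderiv ℝ (fderiv ℝ f) (p t) v) t :=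
        ((hfat.fderiv_right (m := 1) (by norm_num)).differentiableAt
          (by norm_num)).hasFDerivAt.comp_hasDerivAt t (hp_deriv t)
      have h₃ := h₂.clm_apply (hasDerivAt_const t v)
      refine (h₁.add (((hasDerivAt_id t).const_sub 1).mul h₃)).congr_deriv ?_
      simp only [id_eq, map_zero]
      ring
  rw [← hFTC, ← intervalIntegral.integral_const_mul]
  refine (sq_intervalIntegral_le_of_continuousOn hR).trans ?_
  refine intervalIntegral.integral_mono_on zero_le_one (hR.pow 2).intervalIntegrable
    (continuousOn_const.mul ((hw.pow 2).mul (hDp.norm.pow 2))).intervalIntegrable fun t _ => ?_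
  have hop : |fderiv ℝ (fderiv ℝ f) (p t) v v| ≤ ‖iteratedFDeriv ℝ 2 f (p t)‖ * ‖v‖ ^ 2 := by
    have := (iteratedFDeriv ℝ 2 f (p t)).le_opNorm fun _ => v
    simpa [iteratedFDeriv_two_apply] using this
  have hsq := pow_le_pow_left₀ (abs_nonneg _) hop 2
  rw [sq_abs] at hsq
  calc ((1 - t) * fderiv ℝ (fderiv ℝ f) (p t) v v) ^ 2
      = (1 - t) ^ 2 * (fderiv ℝ (fderiv ℝ f) (p t) v v) ^ 2 := by ring
    _ ≤ (1 - t) ^ 2 * (‖iteratedFDeriv ℝ 2 f (p t)‖ * ‖v‖ ^ 2) ^ 2 := by gcongr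
    _ = _ := by ring

lemma lintegral_comp_smul_add_right {E : Type*} [NormedAddCommGroup E] [NormedSpace ℝ E]
    [FiniteDimensional ℝ E] [MeasurableSpace E] [BorelSpace E] (μ : Measure E)
    [μ.IsAddHaarMeasure] {G : E → ENNReal} (hG : Measurable G) {r : ℝ} (hr : r ≠ 0) (v : E) :
    ENNReal.ofReal |r ^ Module.finrank ℝ E| * ∫⁻ y, G (r • y + v) ∂μ = ∫⁻ z, G z ∂μ := by
  have hpos : 0 < |r ^ Module.finrank ℝ E| := abs_pos.2 (pow_ne_zero _ hr)
  have hmap := lintegral_map (μ := μ) (f := fun z => G (z + v)) (g := fun y : E => r • y)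
    (by fun_prop) (by fun_prop)
  rw [← hmap, Measure.map_addHaar_smul μ hr, lintegral_smul_measure, smul_eq_mul, ← mul_assoc,
    ← ENNReal.ofReal_mul hpos.le, abs_inv, mul_inv_cancel₀ hpos.ne', ENNReal.ofReal_one, one_mul,
    lintegral_add_right_eq_self]

/-- In dimension two the weight `(1 - t) ^ 2` is exactly the Jacobian of
`y ↦ (1 - t) • y + t • x`. -/
lemma lintegral_lintegral_lintegral_segment_le {E : Type*} [NormedAddCommGroup E]
    [NormedSpace ℝ E] [FiniteDimensional ℝ E] [MeasurableSpace E] [BorelSpace E] (μ : Measure E)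
    [μ.IsAddHaarMeasure] (hE : Module.finrank ℝ E = 2) {G : E → ENNReal} (hG : Measurable G)
    (Ω : Set E) :
    ∫⁻ y in Ω, ∫⁻ x in Ω, ∫⁻ t in Set.Ioc (0 : ℝ) 1,
        ENNReal.ofReal ((1 - t) ^ 2) * G ((1 - t) • y + t • x) ∂volume ∂μ ∂μ ≤
      μ Ω * ∫⁻ z, G z ∂μ := by
  have hinner (x : E) (t : ℝ) :
      ∫⁻ y in Ω, ENNReal.ofReal ((1 - t) ^ 2) * G ((1 - t) • y + t • x) ∂μ ≤ ∫⁻ z, G z ∂μ := by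
    refine (setLIntegral_le_lintegral _ _).trans ?_
    rw [lintegral_const_mul _ (by fun_prop)]
    rcases eq_or_ne (1 - t) 0 with ht | ht
    · simp [ht]
    · have := lintegral_comp_smul_add_right μ hG ht (t • x)
      rw [hE, abs_of_nonneg (sq_nonneg _)] at this
      exact this.le
  rw [lintegral_lintegral_swap (by fun_prop)]
  calc ∫⁻ x in Ω, ∫⁻ y in Ω, ∫⁻ t in Set.Ioc (0 : ℝ) 1,
        ENNReal.ofReal ((1 - t) ^ 2) * G ((1 - t) • y + t • x) ∂volume ∂μ ∂μ
      ≤ ∫⁻ _ in Ω, ∫⁻ z, G z ∂μ ∂μ := by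
        refine lintegral_mono fun x => ?_
        rw [lintegral_lintegral_swap (by fun_prop)]
        refine (lintegral_mono fun t => hinner x t).trans ?_
        simp
    _ = μ Ω * ∫⁻ z, G z ∂μ := by rw [setLIntegral_const, mul_comm]

lemma IsOpen.measurable_indicator_of_continuousOn {α : Type*} [TopologicalSpace α]
    [MeasurableSpace α] [BorelSpace α] {s : Set α} (hs : IsOpen s) {g : α → ENNReal}
    (hg : ContinuousOn g s) : Measurable (s.indicator g) := by
  classical
  have := hg.measurable_piecewise (g := 0) continuousOn_const hs.measurableSet
  rwa [Set.piecewise_eq_indicator] at this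

/-- Theorem 2 (Bramble–Hilbert type estimate): there is a constant C > 0 such that on every
bounded convex open set Ω ⊂ ℝ² of diameter h, every function twice continuously differentiable
on a neighbourhood of the closure of Ω admits an affine approximation whose L²(Ω) error is
bounded by C·h² times the L² norm of the second derivatives. -/
theorem best_affine_L2_approximation_2d :
    ∃ C : ℝ, 0 < C ∧
      ∀ (Ω : Set (EuclideanSpace ℝ (Fin 2))) (h : ℝ),
        IsOpen Ω → Convex ℝ Ω → Bornology.IsBounded Ω → Metric.diam Ω = h →
        ∀ (f : EuclideanSpace ℝ (Fin 2) → ℝ) (U : Set (EuclideanSpace ℝ (Fin 2))),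
          IsOpen U → closure Ω ⊆ U → ContDiffOn ℝ 2 f U →
          ∃ q : EuclideanSpace ℝ (Fin 2) →ᵃ[ℝ] ℝ,
            Real.sqrt (∫ x in Ω, (f x - q x) ^ 2) ≤
              C * h ^ 2 * Real.sqrt (∫ x in Ω, ‖iteratedFDeriv ℝ 2 f x‖ ^ 2) := by
  refine ⟨1, one_pos, fun Ω h hΩ hconv hbdd hdiam f U hU hΩU hf => ?_⟩
  rcases Ω.eq_empty_or_nonempty with rfl | hne
  · exact ⟨0, by simp⟩
  have hsub : Ω ⊆ U := subset_closure.trans hΩU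
  have hcompact : IsCompact (closure Ω) := hbdd.isCompact_closure
  have hΩ_ne_zero : volume Ω ≠ 0 := (hΩ.measure_pos volume hne).ne'
  have hΩ_ne_top : volume Ω ≠ ⊤ := hbdd.measure_lt_top.ne
  have hD : ContinuousOn (fun z => ‖iteratedFDeriv ℝ 2 f z‖ ^ 2) U :=
    (hf.continuousOn_iteratedFDeriv_two hU).norm.pow 2
  have hD_int : IntegrableOn (fun z => ‖iteratedFDeriv ℝ 2 f z‖ ^ 2) Ω :=
    ((hD.mono hΩU).integrableOn_compact hcompact).mono_set subset_closure
  set G : EuclideanSpace ℝ (Fin 2) → ENNReal :=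
    Ω.indicator fun z => ENNReal.ofReal (‖iteratedFDeriv ℝ 2 f z‖ ^ 2) with hGdef
  have hG : Measurable G := hΩ.measurable_indicator_of_continuousOn
    (ENNReal.continuous_ofReal.comp_continuousOn (hD.mono hsub))
  have hG_int : ∫⁻ z, G z = ENNReal.ofReal (∫ z in Ω, ‖iteratedFDeriv ℝ 2 f z‖ ^ 2) := by
    rw [hGdef, lintegral_indicator hΩ.measurableSet,
      ofReal_integral_eq_lintegral_ofReal hD_int (ae_of_all _ fun _ => by positivity)]
  obtain ⟨y, hy, hy_le⟩ := exists_le_setLAverage (μ := volume) (s := Ω)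
    (f := fun y => ∫⁻ x in Ω, ∫⁻ t in Set.Ioc (0 : ℝ) 1,
      ENNReal.ofReal ((1 - t) ^ 2) * G ((1 - t) • y + t • x)) hΩ_ne_zero hΩ_ne_top
    (by fun_prop)
  have hy_le' : ∫⁻ x in Ω, ∫⁻ t in Set.Ioc (0 : ℝ) 1,
      ENNReal.ofReal ((1 - t) ^ 2) * G ((1 - t) • y + t • x) ≤ ∫⁻ z, G z := by
    refine hy_le.trans ?_
    rw [setLAverage_eq]
    exact ENNReal.div_le_of_le_mul' (lintegral_lintegral_lintegral_segment_le volume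
      finrank_euclideanSpace_fin hG Ω)
  have hmem {x : EuclideanSpace ℝ (Fin 2)} (hx : x ∈ Ω) (t : ℝ) (ht : t ∈ Set.Icc (0 : ℝ) 1) :
      (1 - t) • y + t • x ∈ Ω :=
    hconv hy hx (sub_nonneg.2 ht.2) ht.1 (sub_add_cancel _ _)
  set q : EuclideanSpace ℝ (Fin 2) →ᵃ[ℝ] ℝ :=
    (fderiv ℝ f y).toLinearMap.toAffineMap +
      AffineMap.const ℝ _ (f y - fderiv ℝ f y y) with hqdef
  have hq (x : EuclideanSpace ℝ (Fin 2)) : q x = f y + fderiv ℝ f y (x - y) := by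
    simp [hqdef]; ring
  have hpoint {x : EuclideanSpace ℝ (Fin 2)} (hx : x ∈ Ω) :
      ENNReal.ofReal ((f x - q x) ^ 2) ≤ ENNReal.ofReal (h ^ 4) *
        ∫⁻ t in Set.Ioc (0 : ℝ) 1, ENNReal.ofReal ((1 - t) ^ 2) * G ((1 - t) • y + t • x) := by
    have hnorm : ‖x - y‖ ≤ h := by
      rw [← dist_eq_norm, ← hdiam]; exact Metric.dist_le_diam_of_mem hbdd hx hy
    have hcont : ContinuousOn
        (fun t : ℝ => (1 - t) ^ 2 * ‖iteratedFDeriv ℝ 2 f ((1 - t) • y + t • x)‖ ^ 2)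
        (Set.Icc 0 1) :=
      ContinuousOn.mul (by fun_prop) (hD.comp (by fun_prop) fun t ht => hsub (hmem hx t ht))
    have hint := (hcont.integrableOn_compact (μ := volume) isCompact_Icc).mono_set
      (Set.Ioc_subset_Icc_self (a := (0 : ℝ)) (b := 1))
    have htaylor := taylor_remainder_sq_le hU hf fun t ht => hsub (hmem hx t ht)
    rw [← hq, intervalIntegral.integral_of_le zero_le_one] at htaylor
    refine (ENNReal.ofReal_le_ofReal htaylor).trans ?_
    rw [ENNReal.ofReal_mul (by positivity),
      ofReal_integral_eq_lintegral_ofReal hint (ae_of_all _ fun _ => by positivity)]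
    gcongr ?_ * ?_
    · exact ENNReal.ofReal_le_ofReal (by gcongr)
    · refine setLIntegral_mono' measurableSet_Ioc fun t ht => ?_
      rw [ENNReal.ofReal_mul (sq_nonneg _), hGdef,
        Set.indicator_of_mem (hmem hx t (Set.Ioc_subset_Icc_self ht))]
  have herr_int : IntegrableOn (fun x => (f x - q x) ^ 2) Ω := by
    refine (ContinuousOn.integrableOn_compact hcompact ?_).mono_set subset_closure
    exact ((hf.continuousOn.mono hΩU).sub q.continuous_of_finiteDimensional.continuousOn).pow 2
  have hmain : ∫ x in Ω, (f x - q x) ^ 2 ≤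
      h ^ 4 * ∫ x in Ω, ‖iteratedFDeriv ℝ 2 f x‖ ^ 2 := by
    rw [← ENNReal.ofReal_le_ofReal_iff
        (mul_nonneg (by positivity) (integral_nonneg fun _ => by positivity)),
      ENNReal.ofReal_mul (by positivity), ← hG_int,
      ofReal_integral_eq_lintegral_ofReal herr_int (ae_of_all _ fun _ => by positivity)]
    calc _ ≤ ∫⁻ x in Ω, ENNReal.ofReal (h ^ 4) * ∫⁻ t in Set.Ioc (0 : ℝ) 1,
            ENNReal.ofReal ((1 - t) ^ 2) * G ((1 - t) • y + t • x) :=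
          setLIntegral_mono' hΩ.measurableSet fun x hx => hpoint hx
      _ ≤ _ := by
          rw [lintegral_const_mul' _ _ ENNReal.ofReal_ne_top]
          gcongr
  refine ⟨q, (Real.sqrt_le_sqrt hmain).trans_eq ?_⟩
  rw [show h ^ 4 = (h ^ 2) ^ 2 by ring, Real.sqrt_mul (by positivity),
    Real.sqrt_sq (by positivity), one_mul]
end

section
/- Let a < b, let p be a natural number, and let f : ℝ → ℝ be (p+1)-times continuously differentiable on [a,b]. Let a = a₀ < a₁ < ⋯ < a_J = b be a partition of [a,b] into subintervals I^i = [a_{i−1}, a_i] of lengths h_i = a_i − a_{i−1}. Then there exist polynomials q₁, …, q_J, each of degree at most p, such that ∑_{i=1}^J ‖f − q_i‖²_{L²(I^i)} ≤ (max_{1≤i≤J} h_i)^{2(p+1)} · ‖f^{(p+1)}‖²_{L²(a,b)}. -/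
open MeasureTheory intervalIntegral

open Polynomial in
/-- The Taylor polynomial of degree `n` of `f` at `c`, with derivatives taken within `s`. -/
noncomputable def taylorPolynomialWithin (f : ℝ → ℝ) (n : ℕ) (s : Set ℝ) (c : ℝ) : ℝ[X] :=
  ∑ k ∈ Finset.range (n + 1), C ((k.factorial : ℝ)⁻¹ * iteratedDerivWithin k f s c) * (X - C c) ^ k

theorem natDegree_taylorPolynomialWithin_le (f : ℝ → ℝ) (n : ℕ) (s : Set ℝ) (c : ℝ) :
    (taylorPolynomialWithin f n s c).natDegree ≤ n := by
  refine Polynomial.natDegree_sum_le_of_forall_le _ _ fun k hk => ?_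
  refine (Polynomial.natDegree_C_mul_le _ _).trans ?_
  rw [Polynomial.natDegree_pow, Polynomial.natDegree_X_sub_C, mul_one]
  exact Nat.lt_succ_iff.mp (Finset.mem_range.mp hk)

theorem eval_taylorPolynomialWithin (f : ℝ → ℝ) (n : ℕ) (s : Set ℝ) (c x : ℝ) :
    (taylorPolynomialWithin f n s c).eval x = taylorWithinEval f n s c x := by
  rw [taylor_within_apply, taylorPolynomialWithin, Polynomial.eval_finsetSum]
  refine Finset.sum_congr rfl fun k _ => ?_
  simp only [Polynomial.eval_mul, Polynomial.eval_C, Polynomial.eval_pow, Polynomial.eval_sub,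
    Polynomial.eval_X, smul_eq_mul]
  ring

theorem iteratedDerivWithin_subset {n : ℕ} {f : ℝ → ℝ} {s t : Set ℝ} (st : s ⊆ t)
    (hs : UniqueDiffOn ℝ s) (ht : UniqueDiffOn ℝ t) (hf : ContDiffOn ℝ n f t) {x : ℝ}
    (hx : x ∈ s) : iteratedDerivWithin n f s x = iteratedDerivWithin n f t x := by
  rw [iteratedDerivWithin_eq_iteratedFDerivWithin, iteratedDerivWithin_eq_iteratedFDerivWithin,
    iteratedFDerivWithin_subset st hs ht hf hx]

/-- The Cauchy-Schwarz inequality against the constant function `1`. -/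
theorem sq_intervalIntegral_le {g : ℝ → ℝ} {c d : ℝ} (hcd : c ≤ d)
    (hg : ContinuousOn g (Set.Icc c d)) :
    (∫ t in c..d, g t) ^ 2 ≤ (d - c) * ∫ t in c..d, g t ^ 2 := by
  rcases hcd.eq_or_lt with rfl | hlt
  · simp
  have hg' : ContinuousOn g (Set.uIcc c d) := by rwa [Set.uIcc_of_le hcd]
  have h1 : IntervalIntegrable g volume c d := hg'.intervalIntegrable
  have h2 : IntervalIntegrable (fun t => g t ^ 2) volume c d := (hg'.pow 2).intervalIntegrable
  set I := ∫ t in c..d, g t with hI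
  have key : 0 ≤ ∫ t in c..d, ((d - c) * g t - I) ^ 2 :=
    integral_nonneg hcd fun t _ => sq_nonneg _
  have expand : ∫ t in c..d, ((d - c) * g t - I) ^ 2 =
      (d - c) * ((d - c) * (∫ t in c..d, g t ^ 2) - I ^ 2) := by
    have : ∀ t, ((d - c) * g t - I) ^ 2 =
        (d - c) ^ 2 * g t ^ 2 - 2 * (d - c) * I * g t + I ^ 2 := fun t => by ring
    simp_rw [this]
    rw [integral_add ((h2.const_mul _).sub (h1.const_mul _)) intervalIntegrable_const,
      integral_sub (h2.const_mul _) (h1.const_mul _),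
      intervalIntegral.integral_const_mul, intervalIntegral.integral_const_mul,
      intervalIntegral.integral_const, ← hI, smul_eq_mul]
    ring
  rw [expand] at key
  linarith [nonneg_of_mul_nonneg_right key (sub_pos.mpr hlt)]

/-- Pointwise bound of the Taylor remainder by the `L²` norm of the highest derivative. -/
theorem sq_sub_taylorWithinEval_le {a b c d x : ℝ} (hab : a < b) (hac : a ≤ c) (hdb : d ≤ b)
    (hx : x ∈ Set.Icc c d) {p : ℕ} {f : ℝ → ℝ} (hf : ContDiffOn ℝ (p + 1) f (Set.Icc a b)) :
    (f x - taylorWithinEval f p (Set.Icc a b) c x) ^ 2 ≤ (d - c) ^ (2 * p + 1) *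
      ∫ t in c..d, iteratedDerivWithin (p + 1) f (Set.Icc a b) t ^ 2 := by
  set g := iteratedDerivWithin (p + 1) f (Set.Icc a b) with hg
  have hcd : c ≤ d := hx.1.trans hx.2
  have hdc : 0 ≤ d - c := sub_nonneg.mpr hcd
  rcases hx.1.eq_or_lt with rfl | hcx
  · rw [taylorWithinEval_self, sub_self, zero_pow two_ne_zero]
    exact mul_nonneg (pow_nonneg hdc _) (integral_nonneg hcd fun t _ => sq_nonneg _)
  have hf' : ContDiffOn ℝ (p + 1 : ℕ) f (Set.Icc a b) := by exact_mod_cast hf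
  have hu := uniqueDiffOn_Icc hab
  have hst : Set.Icc c x ⊆ Set.Icc a b := Set.Icc_subset_Icc hac (hx.2.trans hdb)
  have hgc : ContinuousOn g (Set.Icc c d) :=
    (hf'.continuousOn_iteratedDerivWithin le_rfl hu).mono (Set.Icc_subset_Icc hac hdb)
  have hgx : ContinuousOn g (Set.Icc c x) := hgc.mono (Set.Icc_subset_Icc_right hx.2)
  have hsub : ∀ k ≤ p + 1, ∀ t ∈ Set.Icc c x,
      iteratedDerivWithin k f (Set.Icc c x) t = iteratedDerivWithin k f (Set.Icc a b) t :=
    fun k hk t ht => iteratedDerivWithin_subset hst (uniqueDiffOn_Icc hcx) hu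
      (hf'.of_le (by exact_mod_cast hk)) ht
  have htaylor : f x - taylorWithinEval f p (Set.Icc a b) c x =
      ∫ t in c..x, ((x - t) ^ p / p.factorial) * g t := by
    have := taylor_integral_remainder (f := f) (x := x) (x₀ := c) (n := p)
      (by rw [Set.uIcc_of_le hcx.le]; exact hf'.mono hst)
    rw [Set.uIcc_of_le hcx.le] at this
    convert! this using 1
    · simp only [taylor_within_apply]
      congr 1
      refine Finset.sum_congr rfl fun k hk => ?_
      rw [hsub k (Finset.mem_range.mp hk).le c (Set.left_mem_Icc.mpr hcx.le)]
    · refine integral_congr fun t ht => ?_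
      rw [Set.uIcc_of_le hcx.le] at ht
      simp only [smul_eq_mul, hsub (p + 1) le_rfl t ht, hg]
  have hintd : IntervalIntegrable (fun t => g t ^ 2) volume c d :=
    ContinuousOn.intervalIntegrable (by rw [Set.uIcc_of_le hcd]; exact hgc.pow 2)
  have hkc : ContinuousOn (fun t => ((x - t) ^ p / p.factorial) * g t) (Set.Icc c x) :=
    ContinuousOn.mul (by fun_prop) hgx
  have hweight : ∀ t ∈ Set.Icc c x,
      (((x - t) ^ p / p.factorial) * g t) ^ 2 ≤ (d - c) ^ (2 * p) * g t ^ 2 := by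
    intro t ht
    have h0 : 0 ≤ x - t := sub_nonneg.mpr ht.2
    have h1 : (x - t) ^ p / p.factorial ≤ (d - c) ^ p :=
      (div_le_self (pow_nonneg h0 p) (by exact_mod_cast p.factorial_pos)).trans
        (pow_le_pow_left₀ h0 (by linarith [ht.1, hx.2]) p)
    rw [mul_pow, mul_comm 2 p, pow_mul]
    gcongr
  rw [htaylor]
  calc (∫ t in c..x, ((x - t) ^ p / p.factorial) * g t) ^ 2
      ≤ (x - c) * ∫ t in c..x, (((x - t) ^ p / p.factorial) * g t) ^ 2 :=
        sq_intervalIntegral_le hcx.le hkc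
    _ ≤ (x - c) * ∫ t in c..x, (d - c) ^ (2 * p) * g t ^ 2 := by
        refine mul_le_mul_of_nonneg_left (integral_mono_on hcx.le ?_ ?_ hweight)
          (sub_nonneg.mpr hcx.le)
        · exact ContinuousOn.intervalIntegrable (by rw [Set.uIcc_of_le hcx.le]; exact hkc.pow 2)
        · exact ContinuousOn.intervalIntegrable
            (by rw [Set.uIcc_of_le hcx.le]; exact continuousOn_const.mul (hgx.pow 2))
    _ = (x - c) * ((d - c) ^ (2 * p) * ∫ t in c..x, g t ^ 2) := by
        rw [intervalIntegral.integral_const_mul]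
    _ ≤ (d - c) * ((d - c) ^ (2 * p) * ∫ t in c..d, g t ^ 2) := by
        have hle : ∫ t in c..x, g t ^ 2 ≤ ∫ t in c..d, g t ^ 2 :=
          integral_mono_interval le_rfl hcx.le hx.2 (ae_of_all _ fun t => sq_nonneg _) hintd
        have h0 : 0 ≤ ∫ t in c..x, g t ^ 2 := integral_nonneg hcx.le fun t _ => sq_nonneg _
        have := hx.2
        gcongr
    _ = (d - c) ^ (2 * p + 1) * ∫ t in c..d, g t ^ 2 := by ring

/-- On a subinterval, the Taylor polynomial at the left endpoint has the stated `L²` error. -/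
theorem integral_sq_sub_taylorPolynomialWithin_le {a b c d : ℝ} (hab : a < b) (hac : a ≤ c)
    (hcd : c ≤ d) (hdb : d ≤ b) {p : ℕ} {f : ℝ → ℝ}
    (hf : ContDiffOn ℝ (p + 1) f (Set.Icc a b)) :
    ∫ x in c..d, (f x - (taylorPolynomialWithin f p (Set.Icc a b) c).eval x) ^ 2 ≤
      (d - c) ^ (2 * (p + 1)) *
        ∫ t in c..d, iteratedDerivWithin (p + 1) f (Set.Icc a b) t ^ 2 := by
  have hfc : ContinuousOn f (Set.uIcc c d) := by
    rw [Set.uIcc_of_le hcd]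
    exact hf.continuousOn.mono (Set.Icc_subset_Icc hac hdb)
  calc _ ≤ ∫ _ in c..d, (d - c) ^ (2 * p + 1) *
        ∫ t in c..d, iteratedDerivWithin (p + 1) f (Set.Icc a b) t ^ 2 := by
        refine integral_mono_on hcd ?_ intervalIntegrable_const fun x hx => ?_
        · exact ((hfc.sub (Polynomial.continuous _).continuousOn).pow 2).intervalIntegrable
        · rw [eval_taylorPolynomialWithin]
          exact sq_sub_taylorWithinEval_le hab hac hdb hx hf
    _ = _ := by
        rw [intervalIntegral.integral_const, smul_eq_mul]
        ring

theorem sum_integral_fin_adjacent_intervals {g : ℝ → ℝ} {J : ℕ} {pts : Fin (J + 1) → ℝ}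
    (hg : ∀ i : Fin J, IntervalIntegrable g volume (pts i.castSucc) (pts i.succ)) :
    ∑ i : Fin J, ∫ x in (pts i.castSucc)..(pts i.succ), g x =
      ∫ x in (pts 0)..(pts (Fin.last J)), g x := by
  let a : ℕ → ℝ := fun k => if h : k < J + 1 then pts ⟨k, h⟩ else 0
  have ha : ∀ i : Fin (J + 1), a i = pts i := fun i => dif_pos i.isLt
  have hcast : ∀ i : Fin J, a i = pts i.castSucc := fun i => ha i.castSucc
  have hsucc : ∀ i : Fin J, a (i + 1) = pts i.succ := fun i => ha i.succ
  have key := sum_integral_adjacent_intervals (f := g) (μ := volume) (n := J) (a := a)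
    fun k hk => by simpa only [← hcast, ← hsucc] using hg ⟨k, hk⟩
  rw [Finset.sum_range] at key
  simp only [hcast, hsucc] at key
  rw [key, ← ha 0, ← ha (Fin.last J), Fin.val_zero, Fin.val_last]

/-- Piecewise polynomial approximation on a partition a = a₀ < a₁ < ⋯ < a_J = b: the combined
squared L² error is bounded by (max_i h_i)^(2(p+1)) times the squared L² norm of the (p+1)-th
derivative. -/
theorem piecewise_polynomial_L2_approximation (a b : ℝ) (hab : a < b) (p J : ℕ) (hJ : 0 < J)
    (f : ℝ → ℝ) (hf : ContDiffOn ℝ (p + 1) f (Set.Icc a b))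
    (pts : Fin (J + 1) → ℝ) (hmono : StrictMono pts)
    (h0 : pts 0 = a) (hlast : pts (Fin.last J) = b) :
    ∃ q : Fin J → Polynomial ℝ,
      (∀ i, (q i).natDegree ≤ p) ∧
      (∑ i : Fin J, ∫ x in (pts i.castSucc)..(pts i.succ), (f x - (q i).eval x) ^ 2) ≤
        (Finset.univ.sup'
              (Finset.univ_nonempty_iff.mpr (Fin.pos_iff_nonempty.mp hJ))
              fun i : Fin J => pts i.succ - pts i.castSucc) ^ (2 * (p + 1)) *
          ∫ x in a..b, (iteratedDerivWithin (p + 1) f (Set.Icc a b) x) ^ 2 := by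
  have hge : ∀ i, a ≤ pts i := fun i => h0 ▸ hmono.monotone (Fin.zero_le i)
  have hle : ∀ i, pts i ≤ b := fun i => hlast ▸ hmono.monotone (Fin.le_last i)
  have hstep : ∀ i : Fin J, pts i.castSucc ≤ pts i.succ := fun i =>
    (hmono i.castSucc_lt_succ).le
  refine ⟨fun i => taylorPolynomialWithin f p (Set.Icc a b) (pts i.castSucc),
    fun i => natDegree_taylorPolynomialWithin_le _ _ _ _, ?_⟩
  have hgc : ContinuousOn (fun x => iteratedDerivWithin (p + 1) f (Set.Icc a b) x ^ 2)
      (Set.Icc a b) :=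
    (ContDiffOn.continuousOn_iteratedDerivWithin (n := (p + 1 : ℕ)) (by exact_mod_cast hf) le_rfl
      (uniqueDiffOn_Icc hab)).pow 2
  have hsum := sum_integral_fin_adjacent_intervals (pts := pts) fun i =>
    ContinuousOn.intervalIntegrable (by
      rw [Set.uIcc_of_le (hstep i)]
      exact hgc.mono (Set.Icc_subset_Icc (hge _) (hle _)))
  rw [h0, hlast] at hsum
  rw [← hsum, Finset.mul_sum]
  refine Finset.sum_le_sum fun i _ =>
    (integral_sq_sub_taylorPolynomialWithin_le hab (hge _) (hstep i) (hle _) hf).trans ?_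
  refine mul_le_mul_of_nonneg_right (pow_le_pow_left₀ (sub_nonneg.mpr (hstep i)) ?_ _)
    (integral_nonneg (hstep i) fun t _ => sq_nonneg _)
  exact Finset.le_sup' (fun i : Fin J => pts i.succ - pts i.castSucc) (Finset.mem_univ i)
end

section
/- Let a < b, h = b − a, and let e : ℝ → ℝ be continuous on [a,b] and differentiable on (a,b), with derivative e' square integrable on (a,b). Suppose e(x₀) = 0 for some x₀ ∈ [a,b]. Then ‖e‖_{L²(a,b)} ≤ h · ‖e'‖_{L²(a,b)}. -/
open MeasureTheory intervalIntegral

/-- Cauchy–Schwarz against the constant function on an interval. -/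
theorem sq_intervalIntegral_le_s7 {c d : ℝ} (hcd : c ≤ d) {f : ℝ → ℝ}
    (hf : IntervalIntegrable f volume c d)
    (hf2 : IntervalIntegrable (fun x => f x ^ 2) volume c d) :
    (∫ x in c..d, f x) ^ 2 ≤ (d - c) * ∫ x in c..d, f x ^ 2 := by
  rcases hcd.eq_or_lt with rfl | hlt
  · simp
  have hL : 0 < d - c := sub_pos.2 hlt
  set I := ∫ x in c..d, f x with hI
  have h0 : 0 ≤ ∫ x in c..d, ((d - c) * f x - I) ^ 2 :=
    integral_nonneg hcd fun _ _ => sq_nonneg _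
  have h1 : ∫ x in c..d, ((d - c) * f x - I) ^ 2
      = (d - c) ^ 2 * (∫ x in c..d, f x ^ 2) - 2 * (d - c) * I * I + (d - c) * I ^ 2 := by
    have : ∀ x, ((d - c) * f x - I) ^ 2
        = (d - c) ^ 2 * f x ^ 2 - 2 * (d - c) * I * f x + I ^ 2 := fun x => by ring
    simp_rw [this]
    rw [integral_add ((hf2.const_mul _).sub (hf.const_mul _)) intervalIntegrable_const,
      integral_sub (hf2.const_mul _) (hf.const_mul _), intervalIntegral.integral_const_mul,
      intervalIntegral.integral_const_mul, intervalIntegral.integral_const, smul_eq_mul]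
  rw [h1] at h0
  refine le_of_mul_le_mul_left ?_ hL
  linarith

/-- A function with square integrable derivative on a bounded interval has integrable derivative. -/
theorem integrableOn_deriv_of_sq {a b : ℝ} {e e' : ℝ → ℝ}
    (hderiv : ∀ x ∈ Set.Ioo a b, HasDerivAt e (e' x) x)
    (hsq : IntegrableOn (fun x => e' x ^ 2) (Set.Ioo a b)) :
    IntegrableOn e' (Set.Ioo a b) := by
  have hm : AEStronglyMeasurable e' (volume.restrict (Set.Ioo a b)) := by
    refine (measurable_deriv e).aestronglyMeasurable.congr ?_
    filter_upwards [ae_restrict_mem measurableSet_Ioo] with x hx using (hderiv x hx).deriv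
  exact ((memLp_two_iff_integrable_sq hm).2 hsq).integrable one_le_two

/-- Hölder-1/2 estimate for a function with square integrable derivative. -/
theorem sq_sub_le_mul_integral_sq_deriv {a b c d : ℝ} {e e' : ℝ → ℝ}
    (hcont : ContinuousOn e (Set.Icc a b))
    (hderiv : ∀ x ∈ Set.Ioo a b, HasDerivAt e (e' x) x)
    (hsq : IntegrableOn (fun x => e' x ^ 2) (Set.Ioo a b))
    (hac : a ≤ c) (hcd : c ≤ d) (hdb : d ≤ b) :
    (e d - e c) ^ 2 ≤ (b - a) * ∫ x in a..b, e' x ^ 2 := by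
  have hab : a ≤ b := hac.trans (hcd.trans hdb)
  have toInterval : ∀ {f : ℝ → ℝ}, IntegrableOn f (Set.Ioo a b) → IntervalIntegrable f volume a b :=
    fun hf => (intervalIntegrable_iff_integrableOn_Ioo_of_le hab).2 hf
  have hsub : Set.uIcc c d ⊆ Set.uIcc a b := by
    rw [Set.uIcc_of_le hcd, Set.uIcc_of_le hab]
    exact Set.Icc_subset_Icc hac hdb
  have h1 := (toInterval (integrableOn_deriv_of_sq hderiv hsq)).mono_set hsub
  have h2 := (toInterval hsq).mono_set hsub
  rw [← integral_eq_sub_of_hasDerivAt_of_le hcd (hcont.mono (Set.Icc_subset_Icc hac hdb))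
    (fun x hx => hderiv x (Set.Ioo_subset_Ioo hac hdb hx)) h1]
  refine (sq_intervalIntegral_le_s7 hcd h1 h2).trans ?_
  refine mul_le_mul (by linarith) ?_ (integral_nonneg hcd fun _ _ => sq_nonneg _) (by linarith)
  exact integral_mono_interval hac hcd hdb (Filter.Eventually.of_forall fun _ => sq_nonneg _)
    (toInterval hsq)

/-- Poincaré-type inequality for a function with a zero in the interval:
‖e‖_{L²(a,b)} ≤ (b-a)·‖e'‖_{L²(a,b)}. -/
theorem poincare_of_vanishing (a b : ℝ) (hab : a < b) (e e' : ℝ → ℝ)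
    (hcont : ContinuousOn e (Set.Icc a b))
    (hderiv : ∀ x ∈ Set.Ioo a b, HasDerivAt e (e' x) x)
    (hsq : IntegrableOn (fun x => e' x ^ 2) (Set.Ioo a b))
    (x₀ : ℝ) (hx₀ : x₀ ∈ Set.Icc a b) (hzero : e x₀ = 0) :
    Real.sqrt (∫ x in a..b, e x ^ 2) ≤ (b - a) * Real.sqrt (∫ x in a..b, e' x ^ 2) := by
  have hba : 0 ≤ b - a := (sub_pos.2 hab).le
  have hpt : ∀ x ∈ Set.Icc a b, e x ^ 2 ≤ (b - a) * ∫ x in a..b, e' x ^ 2 := fun x hx => by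
    rcases le_total x₀ x with h | h
    · simpa [hzero] using sq_sub_le_mul_integral_sq_deriv hcont hderiv hsq hx₀.1 h hx.2
    · simpa [hzero] using sq_sub_le_mul_integral_sq_deriv hcont hderiv hsq hx.1 h hx₀.2
  have hint : IntervalIntegrable (fun x => e x ^ 2) volume a b :=
    ContinuousOn.intervalIntegrable_of_Icc hab.le (hcont.pow 2)
  have hle := integral_mono_on hab.le hint intervalIntegrable_const hpt
  rw [intervalIntegral.integral_const, smul_eq_mul] at hle
  refine (Real.sqrt_le_sqrt hle).trans_eq ?_
  rw [← mul_assoc, Real.sqrt_mul (mul_nonneg hba hba), Real.sqrt_mul_self hba]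
end

section
/- Let a < b, h = b − a, let p be a natural number, and let e : ℝ → ℝ be (p+1)-times continuously differentiable on [a,b]. Suppose e vanishes at p+1 distinct points of [a,b]. Then ‖e‖_{L²(a,b)} ≤ h^{p+1} · ‖e^{(p+1)}‖_{L²(a,b)}. -/
open MeasureTheory intervalIntegral

/-- Cauchy-Schwarz against the constant function `1` on an interval. -/
theorem sq_integral_le_mul_integral_sq {u v : ℝ} (huv : u ≤ v) {f : ℝ → ℝ}
    (hf : ContinuousOn f (Set.Icc u v)) :
    (∫ t in u..v, f t) ^ 2 ≤ (v - u) * ∫ t in u..v, f t ^ 2 := by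
  rcases huv.eq_or_lt with rfl | huv'
  · simp
  have hf1 : IntervalIntegrable f volume u v := hf.intervalIntegrable_of_Icc huv
  have hf2 : IntervalIntegrable (fun t => f t ^ 2) volume u v :=
    (hf.pow 2).intervalIntegrable_of_Icc huv
  set m := ∫ t in u..v, f t with hm
  have hexp : ∫ t in u..v, ((v - u) * f t - m) ^ 2 =
      (v - u) ^ 2 * (∫ t in u..v, f t ^ 2) - 2 * (v - u) * m * m + (v - u) * m ^ 2 := by
    have hrw : ∀ t, ((v - u) * f t - m) ^ 2 =
        (v - u) ^ 2 * f t ^ 2 - 2 * (v - u) * m * f t + m ^ 2 := fun t => by ring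
    simp_rw [hrw]
    rw [intervalIntegral.integral_add ((hf2.const_mul _).sub (hf1.const_mul _))
        intervalIntegrable_const,
      intervalIntegral.integral_sub (hf2.const_mul _) (hf1.const_mul _),
      intervalIntegral.integral_const_mul, intervalIntegral.integral_const_mul,
      intervalIntegral.integral_const, ← hm, smul_eq_mul]
  have hnonneg : 0 ≤ ∫ t in u..v, ((v - u) * f t - m) ^ 2 :=
    integral_nonneg huv fun t _ => sq_nonneg _
  have hpos : 0 < v - u := sub_pos.2 huv'
  refine le_of_mul_le_mul_left ?_ hpos
  nlinarith

theorem sq_sub_le_mul_integral_sq_derivWithin {a b u v : ℝ} {f : ℝ → ℝ}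
    (hf : ContDiffOn ℝ 1 f (Set.Icc a b)) (hau : a ≤ u) (huv : u ≤ v) (hvb : v ≤ b) :
    (f v - f u) ^ 2 ≤ (b - a) * ∫ t in a..b, derivWithin f (Set.Icc a b) t ^ 2 := by
  rcases (hau.trans (huv.trans hvb)).eq_or_lt with rfl | hab
  · obtain rfl : u = v := by linarith
    simp
  have hsub : Set.Icc u v ⊆ Set.Icc a b := Set.Icc_subset_Icc hau hvb
  have hd : ContinuousOn (derivWithin f (Set.Icc a b)) (Set.Icc a b) :=
    hf.continuousOn_derivWithin (uniqueDiffOn_Icc hab) le_rfl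
  have hftc : ∫ t in u..v, derivWithin f (Set.Icc a b) t = f v - f u := by
    refine integral_eq_sub_of_hasDerivAt_of_le huv (hf.continuousOn.mono hsub) (fun t ht => ?_)
      ((hd.mono hsub).intervalIntegrable_of_Icc huv)
    have hta : a < t := hau.trans_lt ht.1
    have htb : t < b := ht.2.trans_le hvb
    exact ((hf.differentiableOn one_ne_zero) t ⟨hta.le, htb.le⟩).hasDerivWithinAt.hasDerivAt
      (Icc_mem_nhds hta htb)
  rw [← hftc]
  refine (sq_integral_le_mul_integral_sq huv (hd.mono hsub)).trans ?_
  refine mul_le_mul (by linarith) ?_ (integral_nonneg huv fun t _ => sq_nonneg _) (by linarith)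
  exact integral_mono_interval hau huv hvb (Filter.Eventually.of_forall fun t => sq_nonneg _)
    ((hd.pow 2).intervalIntegrable_of_Icc hab.le)

/-- Poincaré inequality for a function with a zero in the interval. -/
theorem sqrt_integral_sq_le_of_eq_zero {a b c : ℝ} (hab : a ≤ b) {f : ℝ → ℝ}
    (hf : ContDiffOn ℝ 1 f (Set.Icc a b)) (hc : c ∈ Set.Icc a b) (hfc : f c = 0) :
    Real.sqrt (∫ t in a..b, f t ^ 2) ≤
      (b - a) * Real.sqrt (∫ t in a..b, derivWithin f (Set.Icc a b) t ^ 2) := by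
  have hba : 0 ≤ b - a := sub_nonneg.2 hab
  set D := ∫ t in a..b, derivWithin f (Set.Icc a b) t ^ 2
  have hpt : ∀ t ∈ Set.Icc a b, f t ^ 2 ≤ (b - a) * D := by
    intro t ht
    rcases le_total c t with h | h
    · simpa [hfc] using sq_sub_le_mul_integral_sq_derivWithin hf hc.1 h ht.2
    · simpa [hfc] using sq_sub_le_mul_integral_sq_derivWithin hf ht.1 h hc.2
  have hsq : ∫ t in a..b, f t ^ 2 ≤ (b - a) ^ 2 * D := by
    refine (integral_mono_on hab ((hf.continuousOn.pow 2).intervalIntegrable_of_Icc hab)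
      intervalIntegrable_const hpt).trans_eq ?_
    rw [intervalIntegral.integral_const, smul_eq_mul]
    ring
  calc Real.sqrt (∫ t in a..b, f t ^ 2) ≤ Real.sqrt ((b - a) ^ 2 * D) := Real.sqrt_le_sqrt hsq
    _ = (b - a) * Real.sqrt D := by
      rw [Real.sqrt_mul (sq_nonneg _), Real.sqrt_sq hba]

/-- Rolle's theorem for the derivative within an interval, applied between consecutive zeros. -/
theorem exists_strictMono_derivWithin_eq_zero {a b : ℝ} {n : ℕ} {f : ℝ → ℝ}
    (hf : ContinuousOn f (Set.Icc a b)) {x : Fin (n + 1) → ℝ} (hx : StrictMono x)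
    (hxmem : ∀ i, x i ∈ Set.Icc a b) (hzero : ∀ i, f (x i) = 0) :
    ∃ y : Fin n → ℝ, StrictMono y ∧ (∀ i, y i ∈ Set.Icc a b) ∧
      ∀ i, derivWithin f (Set.Icc a b) (y i) = 0 := by
  have hrolle : ∀ i : Fin n, ∃ c ∈ Set.Ioo (x i.castSucc) (x i.succ), deriv f c = 0 := fun i =>
    exists_deriv_eq_zero (hx i.castSucc_lt_succ)
      (hf.mono (Set.Icc_subset_Icc (hxmem _).1 (hxmem _).2)) (by rw [hzero, hzero])
  choose y hy hy0 using hrolle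
  have hya : ∀ i, a < y i := fun i => (hxmem _).1.trans_lt (hy i).1
  have hyb : ∀ i, y i < b := fun i => (hy i).2.trans_le (hxmem _).2
  refine ⟨y, fun i j hij => ?_, fun i => ⟨(hya i).le, (hyb i).le⟩, fun i => ?_⟩
  · exact (hy i).2.trans_le ((hx.monotone (Fin.succ_le_castSucc_iff.2 hij)).trans (hy j).1.le)
  · rw [derivWithin_of_mem_nhds (Icc_mem_nhds (hya i) (hyb i)), hy0]

/-- Chained estimate from the proof of Proposition 2: if e is (p+1)-times continuously
differentiable on [a,b] and vanishes at p+1 distinct points of [a,b], then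
‖e‖_{L²(a,b)} ≤ (b-a)^(p+1)·‖e^{(p+1)}‖_{L²(a,b)}. -/
theorem vanishing_points_L2_bound (a b : ℝ) (hab : a < b) (p : ℕ) (e : ℝ → ℝ)
    (he : ContDiffOn ℝ (p + 1) e (Set.Icc a b))
    (x : Fin (p + 1) → ℝ) (hx : StrictMono x) (hxmem : ∀ i, x i ∈ Set.Icc a b)
    (hzero : ∀ i, e (x i) = 0) :
    Real.sqrt (∫ t in a..b, e t ^ 2) ≤
      (b - a) ^ (p + 1) *
        Real.sqrt (∫ t in a..b, (iteratedDerivWithin (p + 1) e (Set.Icc a b) t) ^ 2) := by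
  have hpoincare := sqrt_integral_sq_le_of_eq_zero hab.le (he.of_le (by simp)) (hxmem 0) (hzero 0)
  induction p generalizing e with
  | zero => simpa [iteratedDerivWithin_one] using hpoincare
  | succ p ih =>
    obtain ⟨y, hy, hymem, hy0⟩ :=
      exists_strictMono_derivWithin_eq_zero he.continuousOn hx hxmem hzero
    have hd : ContDiffOn ℝ (p + 1) (derivWithin e (Set.Icc a b)) (Set.Icc a b) :=
      he.derivWithin (uniqueDiffOn_Icc hab) (by push_cast; exact le_rfl)
    have hstep := ih _ hd y hy hymem hy0
      (sqrt_integral_sq_le_of_eq_zero hab.le (hd.of_le (by simp)) (hymem 0) (hy0 0))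
    simp_rw [iteratedDerivWithin_succ' (n := p + 1)]
    refine hpoincare.trans ((mul_le_mul_of_nonneg_left hstep (sub_nonneg.2 hab.le)).trans_eq ?_)
    rw [← mul_assoc, ← pow_succ']
end
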